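/- arXiv:2312.11752 — 2 statements merged into one kernel-verified Lean document; each statement's English description precedes it below -/
import Mathlib

section
/- Let γ ∈ (0,1), C > 0, let F : ℝ^s × ℝ^a → ℝ^s be globally Lipschitz, let r : ℝ^s → [0,1] be smooth, and fix an arbitrary initial condition (s₀,a₀) ∈ ℝ^s × ℝ^a. Consider the class 𝒜 of smooth vector fields Ψ : ℝ^s × ℝ^a → ℝ^a that are Lipschitz and satisfy ‖Ψ(s,a)‖₂ ≤ C for all (s,a). Suppose Ψ* ∈ 𝒜 maximizes J(Ψ) = Q^Ψ(s₀,a₀) over 𝒜, and suppose Q^{Ψ*} is differentiable along the trajectory (s(t,s₀,a₀), a(t,s₀,a₀)) of the Ψ*-dynamics started at (s₀,a₀). Then for every t ≥ 0, writing (s,a) = (s(t,s₀,a₀), a(t,s₀,a₀)), if ∇_a Q^{Ψ*}(s,a) ≠ 𝟎 then there exists α_{s,a} > 0 such that Ψ*(s,a) = α_{s,a} · ∇_a Q^{Ψ*}(s,a). -/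
open MeasureTheory Real Set

/-- The admissible class `𝒜`: smooth vector fields `Ψ : ℝˢ × ℝᵃ → ℝᵃ` that are
Lipschitz and uniformly bounded in norm by `C`. -/
def QSM.Admissible {ns na : ℕ} (C : ℝ)
    (Ψ : EuclideanSpace ℝ (Fin ns) → EuclideanSpace ℝ (Fin na) →
      EuclideanSpace ℝ (Fin na)) : Prop :=
  ContDiff ℝ (⊤ : ℕ∞) (fun p : EuclideanSpace ℝ (Fin ns) × EuclideanSpace ℝ (Fin na) =>
      Ψ p.1 p.2) ∧
  (∃ K : NNReal, LipschitzWith K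
    (fun p : EuclideanSpace ℝ (Fin ns) × EuclideanSpace ℝ (Fin na) => Ψ p.1 p.2)) ∧
  ∀ s a, ‖Ψ s a‖ ≤ C


namespace QSMaux

set_option linter.unusedSectionVars false

open Filter Topology

lemma gron_le {d K e x : ℝ} (hK : 0 < K) (he : 0 ≤ e) (_hx : 0 ≤ x) :
    gronwallBound d K e x ≤ (d + e * x) * Real.exp (K * x) := by
  rw [gronwallBound_of_K_ne_0 hK.ne']
  have h1 : Real.exp (K * x) - 1 ≤ (K * x) * Real.exp (K * x) := by
    have h := Real.add_one_le_exp (-(K * x))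
    have h2 : Real.exp (K * x) * Real.exp (-(K * x)) = 1 := by
      rw [← Real.exp_add]; simp
    nlinarith [Real.exp_pos (K * x)]
  have h3 : e / K * (Real.exp (K * x) - 1) ≤ e / K * ((K * x) * Real.exp (K * x)) := by
    gcongr
  have h4 : e / K * ((K * x) * Real.exp (K * x)) = e * x * Real.exp (K * x) := by
    field_simp
  show d * Real.exp (K * x) + e / K * (Real.exp (K * x) - 1) ≤ _
  nlinarith

structure QD (E : Type*) [NormedAddCommGroup E] [NormedSpace ℝ E] where
  γ : ℝ
  K : NNReal
  m : ℝ
  f : E → E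
  Φ : E → ℝ → E
  ρ : E → ℝ
  P : E → E
  hγ0 : 0 < γ
  hγ1 : γ < 1
  hK : 0 < K
  hm : 0 < m
  hf : LipschitzWith K f
  Φc : ∀ p, Continuous (Φ p)
  Φ0 : ∀ p, Φ p 0 = p
  Φd : ∀ p t, 0 ≤ t → HasDerivWithinAt (Φ p) (f (Φ p t)) (Ici t) t
  ρc : Continuous ρ
  ρ0 : ∀ z, 0 ≤ ρ z
  ρ1 : ∀ z, ρ z ≤ 1
  Pc : Continuous P
  Pm : ∀ z, ‖P z‖ ≤ m

variable {E : Type*} [NormedAddCommGroup E] [NormedSpace ℝ E] 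

noncomputable def QD.J (S : QD E) (x : ℝ → E) : ℝ := ∫ t in Ioi (0:ℝ), S.γ ^ t * S.ρ (x t)
noncomputable def QD.q (S : QD E) (p : E) : ℝ := S.J (S.Φ p)

structure QD.Sol (S : QD E) (ψ : E → ℝ) (x : ℝ → E) : Prop where
  ψc : Continuous ψ
  ψ0 : ∀ z, 0 ≤ ψ z
  xc : Continuous x
  xd : ∀ t, 0 ≤ t → HasDerivWithinAt x (S.f (x t) + ψ (x t) • S.P (x t)) (Ici t) t

lemma QD.Φsol (S : QD E) (p : E) : S.Sol (fun _ => 0) (S.Φ p) :=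
  ⟨continuous_const, fun _ => le_rfl, S.Φc p, fun t ht => by simpa using S.Φd p t ht⟩

lemma QD.Kpos (S : QD E) : 0 < (S.K : ℝ) := S.hK

lemma QD.fl (S : QD E) (z w : E) : ‖S.f z - S.f w‖ ≤ S.K * ‖z - w‖ := by
  simpa [dist_eq_norm] using S.hf.dist_le_mul z w

/-- shifted old trajectory -/
lemma QD.Φsd (S : QD E) (p : E) (a t : ℝ) (h : a ≤ t) :
    HasDerivWithinAt (fun u => S.Φ p (u - a)) (S.f (S.Φ p (t - a))) (Ici t) t := by
  have h1 := S.Φd p (t - a) (by linarith)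
  have h2 : HasDerivWithinAt (fun u : ℝ => u - a) 1 (Ici t) t :=
    ((hasDerivAt_id t).sub_const a).hasDerivWithinAt
  have := HasDerivWithinAt.scomp t h1 h2 (fun u hu => by simp at hu ⊢; linarith)
  simpa [Function.comp_def] using this

lemma QD.gpow_cont (S : QD E) : Continuous (fun t : ℝ => S.γ ^ t) :=
  Real.continuous_const_rpow S.hγ0.ne'

lemma QD.gint (S : QD E) (a : ℝ) : IntegrableOn (fun t : ℝ => S.γ ^ t) (Ioi a) := by
  have hl : 0 < - Real.log S.γ := by
    have := Real.log_neg S.hγ0 S.hγ1; linarith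
  refine (exp_neg_integrableOn_Ioi a hl).congr_fun (fun t _ => ?_) measurableSet_Ioi
  simp [Real.rpow_def_of_pos S.hγ0]

lemma QD.gρint (S : QD E) {x : ℝ → E} (hx : Continuous x) (a : ℝ) :
    IntegrableOn (fun t : ℝ => S.γ ^ t * S.ρ (x t)) (Ioi a) := by
  refine (S.gint a).mono' (S.gpow_cont.mul (S.ρc.comp hx)).aestronglyMeasurable ?_
  refine ae_of_all _ fun t => ?_
  have h := Real.rpow_pos_of_pos S.hγ0 t
  rw [Real.norm_of_nonneg (mul_nonneg h.le (S.ρ0 _))]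
  nlinarith [S.ρ1 (x t)]

lemma QD.J_nonneg (S : QD E) (x : ℝ → E) : 0 ≤ S.J x :=
  setIntegral_nonneg measurableSet_Ioi
    (fun t _ => mul_nonneg (Real.rpow_pos_of_pos S.hγ0 t).le (S.ρ0 _))

lemma QD.J_le (S : QD E) {x : ℝ → E} (hx : Continuous x) :
    S.J x ≤ ∫ t in Ioi (0:ℝ), S.γ ^ t := by
  refine setIntegral_mono_on (S.gρint hx 0) (S.gint 0) measurableSet_Ioi (fun t _ => ?_)
  have h := Real.rpow_pos_of_pos S.hγ0 t
  nlinarith [S.ρ1 (x t)]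

/-- near lemma -/
lemma QD.near (S : QD E) {ψ : E → ℝ} {x : ℝ → E} (hx : S.Sol ψ x) {β : ℝ} (hψ : ∀ z, ψ z ≤ β)
    (zs : E) {a b d : ℝ} (ha : 0 ≤ a) (hd : ‖x a - zs‖ ≤ d) (hL : S.K * (b - a) ≤ 1 / 2) :
    ∀ u ∈ Icc a b, ‖x u - zs‖ ≤ 2 * (d + (‖S.f zs‖ + S.m * β) * (b - a)) := by
  intro u hu
  have hβ : 0 ≤ β := (hx.ψ0 zs).trans (hψ zs)
  have hW : 0 ≤ ‖S.f zs‖ + S.m * β := by have := S.hm; positivity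
  have h := norm_le_gronwallBound_of_norm_deriv_right_le (f := fun t => x t - zs)
    (f' := fun t => S.f (x t) + ψ (x t) • S.P (x t)) (δ := d) (K := S.K)
    (ε := ‖S.f zs‖ + S.m * β) (a := a) (b := b)
    (hx.xc.sub continuous_const).continuousOn
    (fun t ht => (hx.xd t (ha.trans ht.1)).sub_const zs) hd
    (fun t ht => by
      have e : S.f (x t) + ψ (x t) • S.P (x t)
        = (S.f (x t) - S.f zs) + S.f zs + ψ (x t) • S.P (x t) := by abel
      rw [e]
      refine (norm_add₃_le).trans ?_
      have h1 := S.fl (x t) zs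
      have h2 : ‖ψ (x t) • S.P (x t)‖ ≤ S.m * β := by
        rw [norm_smul, Real.norm_of_nonneg (hx.ψ0 _), mul_comm]
        exact mul_le_mul (S.Pm _) (hψ _) (hx.ψ0 _) S.hm.le
      linarith) u hu
  have hd0 : 0 ≤ d := (norm_nonneg _).trans hd
  have hua : 0 ≤ u - a := by linarith [hu.1]
  refine h.trans ((gron_le S.Kpos hW hua).trans ?_)
  have h2 : Real.exp (S.K * (u - a)) ≤ 2 := by
    have : S.K * (u - a) ≤ 1 / 2 := by
      have : S.K * (u - a) ≤ S.K * (b - a) := by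
        have := S.Kpos
        have := hu.2
        gcongr
      linarith
    calc Real.exp (S.K * (u - a)) ≤ Real.exp (Real.log 2) := by
          apply Real.exp_le_exp.2; linarith [Real.log_two_gt_d9]
      _ = 2 := Real.exp_log (by norm_num)
  have h3 : d + (‖S.f zs‖ + S.m * β) * (u - a) ≤ d + (‖S.f zs‖ + S.m * β) * (b - a) := by
    have := hu.2
    gcongr
  have h4 : 0 ≤ d + (‖S.f zs‖ + S.m * β) * (u - a) := by positivity
  nlinarith [Real.exp_pos (S.K * (u - a))]

variable [CompleteSpace E]

/-- deviation lemma -/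
lemma QD.dev (S : QD E) {ψ : E → ℝ} {x y : ℝ → E} (hx : S.Sol ψ x) {a b : ℝ} (ha : 0 ≤ a)
    (hyc : Continuous y)
    (hyd : ∀ t, a ≤ t → HasDerivWithinAt y (S.f (y t)) (Ici t) t) (hxy : x a = y a) :
    ∀ u ∈ Icc a b, ‖x u - y u‖ ≤
      S.m * (∫ t in a..b, ψ (x t)) * (1 + S.K * (b - a) * Real.exp (S.K * (b - a))) := by
  intro u hu
  have hab : a ≤ b := hu.1.trans hu.2
  have hec : Continuous (fun t => ψ (x t) • S.P (x t)) :=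
    (hx.ψc.comp hx.xc).smul (S.Pc.comp hx.xc)
  have hψc : Continuous (fun t => ψ (x t)) := hx.ψc.comp hx.xc
  set I := ∫ t in a..b, ψ (x t) with hI
  have hI0 : 0 ≤ I := intervalIntegral.integral_nonneg hab (fun t _ => hx.ψ0 _)
  set w : ℝ → E := fun s => ∫ t in a..s, ψ (x t) • S.P (x t) with hw
  have hwb : ∀ s ∈ Icc a b, ‖w s‖ ≤ S.m * I := by
    intro s hs
    have h1 : ‖w s‖ ≤ ∫ t in a..s, S.m * ψ (x t) := by
      refine intervalIntegral.norm_integral_le_of_norm_le hs.1 (ae_of_all _ fun t _ => ?_)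
        ((hψc.const_mul S.m).intervalIntegrable _ _)
      rw [norm_smul, Real.norm_of_nonneg (hx.ψ0 _), mul_comm]
      exact mul_le_mul_of_nonneg_right (S.Pm _) (hx.ψ0 _)
    rw [intervalIntegral.integral_const_mul] at h1
    refine h1.trans (mul_le_mul_of_nonneg_left ?_ S.hm.le)
    exact intervalIntegral.integral_mono_interval le_rfl hs.1 hs.2
      (ae_of_all _ fun t => hx.ψ0 _) (hψc.intervalIntegrable _ _)
  have hwd : ∀ s, HasDerivAt w (ψ (x s) • S.P (x s)) s := fun s =>
    (hec.integral_hasStrictDerivAt a s).hasDerivAt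
  have hwc : Continuous w := continuous_iff_continuousAt.2 fun s => (hwd s).continuousAt
  have hB : 0 ≤ S.m * I := mul_nonneg S.hm.le hI0
  have h := norm_le_gronwallBound_of_norm_deriv_right_le (f := fun t => x t - y t - w t)
    (f' := fun t => S.f (x t) + ψ (x t) • S.P (x t) - S.f (y t) - ψ (x t) • S.P (x t))
    (δ := 0) (K := S.K) (ε := S.K * (S.m * I)) (a := a) (b := b)
    ((hx.xc.sub hyc).sub hwc).continuousOn
    (fun t ht => ((hx.xd t (ha.trans ht.1)).sub (hyd t ht.1)).sub (hwd t).hasDerivWithinAt)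
    (by simp [hw, hxy])
    (fun t ht => by
      have e : S.f (x t) + ψ (x t) • S.P (x t) - S.f (y t) - ψ (x t) • S.P (x t)
        = S.f (x t) - S.f (y t) := by abel
      rw [e]
      refine (S.fl _ _).trans ?_
      have h2 : ‖x t - y t‖ ≤ ‖x t - y t - w t‖ + ‖w t‖ := by
        have := norm_add_le (x t - y t - w t) (w t)
        simpa using this
      have h3 := hwb t ⟨ht.1, ht.2.le⟩
      rw [← mul_add]
      exact mul_le_mul_of_nonneg_left (by linarith) S.Kpos.le) u hu
  have hua : 0 ≤ u - a := by linarith [hu.1]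
  have h1 := h.trans (gron_le S.Kpos (mul_nonneg S.Kpos.le hB) hua)
  have h2 : ‖x u - y u‖ ≤ ‖x u - y u - w u‖ + ‖w u‖ := by
    have := norm_add_le (x u - y u - w u) (w u)
    simpa using this
  have h3 := hwb u hu
  have h4 : (0 + S.K * (S.m * I) * (u - a)) * Real.exp (S.K * (u - a)) ≤
      (S.K * (S.m * I) * (b - a)) * Real.exp (S.K * (b - a)) := by
    rw [zero_add]
    have := S.Kpos
    have := hu.2
    gcongr
  calc ‖x u - y u‖ ≤ (S.K * (S.m * I) * (b - a)) * Real.exp (S.K * (b - a)) + S.m * I := by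
        linarith
    _ = _ := by ring

lemma QD.eq_of_zero (S : QD E) {ψ : E → ℝ} {x : ℝ → E} (hx : S.Sol ψ x) {a b : ℝ} (ha : 0 ≤ a)
    (hz : ∀ t ∈ Icc a b, ψ (x t) = 0) : ∀ u ∈ Icc a b, x u = S.Φ (x a) (u - a) := by
  intro u hu
  have hab : a ≤ b := hu.1.trans hu.2
  have h := S.dev (b := b) hx ha (y := fun u => S.Φ (x a) (u - a))
    ((S.Φc _).comp (continuous_id.sub continuous_const))
    (fun t ht => S.Φsd _ a t ht) (by simp [S.Φ0]) u hu
  have hI : ∫ t in a..b, ψ (x t) = 0 := by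
    rw [intervalIntegral.integral_congr (g := fun _ => (0:ℝ))]
    · simp
    · intro t ht; rw [uIcc_of_le hab] at ht; exact hz t ht
  rw [hI] at h
  simp only [mul_zero, zero_mul] at h
  exact sub_eq_zero.1 (norm_le_zero_iff.1 h)

lemma QD.semigroup (S : QD E) (p : E) {h : ℝ} (hh : 0 ≤ h) (u : ℝ) (hu : 0 ≤ u) :
    S.Φ (S.Φ p h) u = S.Φ p (u + h) := by
  have := S.eq_of_zero (S.Φsol p) hh (b := u + h) (fun _ _ => rfl) (u + h) ⟨by linarith, le_rfl⟩
  rw [this]; simp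

lemma QD.q_step (S : QD E) (p : E) {a b : ℝ} (hab : a ≤ b) :
    S.γ ^ a * S.q p = (∫ u in a..b, S.γ ^ u * S.ρ (S.Φ p (u - a)))
      + S.γ ^ b * S.q (S.Φ p (b - a)) := by
  have shift : ∀ (c : ℝ) (g : ℝ → ℝ), ∫ t in Ioi (0:ℝ), g (t + c) = ∫ t in Ioi c, g t := by
    intro c g
    have := (measurePreserving_add_right (volume : Measure ℝ) c).setIntegral_preimage_emb
      (MeasurableEquiv.addRight c).measurableEmbedding g (Ioi c)
    simpa using this
  have e1 : S.γ ^ a * S.q p = ∫ t in Ioi a, S.γ ^ t * S.ρ (S.Φ p (t - a)) := by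
    rw [← shift a, QD.q, QD.J, ← integral_const_mul]
    refine integral_congr_ae (ae_of_all _ fun t => ?_)
    simp only [add_sub_cancel_right, Real.rpow_add S.hγ0]; ring
  have e2 : S.γ ^ b * S.q (S.Φ p (b - a)) = ∫ t in Ioi b, S.γ ^ t * S.ρ (S.Φ p (t - a)) := by
    rw [← shift b, QD.q, QD.J, ← integral_const_mul]
    refine setIntegral_congr_fun measurableSet_Ioi fun t ht => ?_
    have := S.semigroup p (h := b - a) (by linarith) t (le_of_lt ht)
    simp only [this, Real.rpow_add S.hγ0, add_sub_assoc]; ring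
  rw [e1, e2]
  have hc : Continuous (fun t => S.Φ p (t - a)) :=
    (S.Φc _).comp (continuous_id.sub continuous_const)
  exact (intervalIntegral.integral_interval_add_Ioi (S.gρint hc a) (S.gρint hc b)).symm

noncomputable def QD.V (S : QD E) (x : ℝ → E) (t : ℝ) : ℝ :=
  (∫ u in (0:ℝ)..t, S.γ ^ u * S.ρ (x u)) + S.γ ^ t * S.q (x t)

lemma QD.V_step (S : QD E) {x : ℝ → E} (hx : Continuous x) {a b : ℝ} (hab : a ≤ b) :
    S.V x b - S.V x a = (∫ u in a..b, S.γ ^ u * (S.ρ (x u) - S.ρ (S.Φ (x a) (u - a))))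
      + S.γ ^ b * (S.q (x b) - S.q (S.Φ (x a) (b - a))) := by
  have hc : Continuous (fun t => S.γ ^ t * S.ρ (x t)) := S.gpow_cont.mul (S.ρc.comp hx)
  have hc2 : Continuous (fun t => S.γ ^ t * S.ρ (S.Φ (x a) (t - a))) :=
    S.gpow_cont.mul (S.ρc.comp ((S.Φc _).comp (continuous_id.sub continuous_const)))
  have h1 := intervalIntegral.integral_add_adjacent_intervals
    (hc.intervalIntegrable (μ := volume) 0 a) (hc.intervalIntegrable a b)
  have h2 := S.q_step (x a) hab
  simp only [mul_sub]
  rw [intervalIntegral.integral_sub (hc.intervalIntegrable _ _) (hc2.intervalIntegrable _ _)]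
  unfold QD.V
  rw [← h1]
  linarith

lemma QD.V_zero (S : QD E) {ψ : E → ℝ} {x : ℝ → E} (hx : S.Sol ψ x) {a b : ℝ} (ha : 0 ≤ a)
    (hab : a ≤ b) (hz : ∀ t ∈ Icc a b, ψ (x t) = 0) : S.V x b = S.V x a := by
  have h := S.V_step hx.xc hab
  have he := S.eq_of_zero hx ha hz
  rw [← he b ⟨hab, le_rfl⟩, intervalIntegral.integral_congr (g := fun _ => (0:ℝ))] at h
  · simp at h; linarith
  · intro t ht
    rw [uIcc_of_le hab] at ht
    simp only [← he t ht]; simp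

lemma QD.V_tendsto (S : QD E) {x : ℝ → E} (hx : Continuous x) :
    Tendsto (S.V x) atTop (𝓝 (S.J x)) := by
  have h1 : Tendsto (fun t : ℝ => ∫ u in (0:ℝ)..t, S.γ ^ u * S.ρ (x u)) atTop (𝓝 (S.J x)) :=
    intervalIntegral_tendsto_integral_Ioi 0 (S.gρint hx 0) tendsto_id
  have h0 : Tendsto (fun t : ℝ => S.γ ^ t) atTop (𝓝 0) :=
    tendsto_rpow_atTop_of_base_lt_one _ (by linarith [S.hγ0]) S.hγ1
  have h2 : Tendsto (fun t : ℝ => S.γ ^ t * S.q (x t)) atTop (𝓝 0) := by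
    have h3 := h0.mul_const (∫ t in Ioi (0:ℝ), S.γ ^ t)
    rw [zero_mul] at h3
    refine squeeze_zero (fun t => ?_) (fun t => ?_) h3
    · exact mul_nonneg (Real.rpow_pos_of_pos S.hγ0 t).le (S.J_nonneg _)
    · exact mul_le_mul_of_nonneg_left (S.J_le (S.Φc _)) (Real.rpow_pos_of_pos S.hγ0 t).le
  have h4 := h1.add h2
  rw [add_zero] at h4
  exact h4

lemma QD.V_zero' (S : QD E) {ψ : E → ℝ} {x : ℝ → E} (hx : S.Sol ψ x) {a b : ℝ} (ha : 0 ≤ a)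
    (hab : a ≤ b) (hz : ∀ t ∈ Ioo a b, ψ (x t) = 0) :
    S.V x b = S.V x a ∧ ∫ u in a..b, S.γ ^ u * ψ (x u) = 0 := by
  rcases hab.eq_or_lt with rfl | hlt
  · simp
  have hcl : IsClosed {t | ψ (x t) = 0} :=
    isClosed_eq (hx.ψc.comp hx.xc) continuous_const
  have hz' : ∀ t ∈ Icc a b, ψ (x t) = 0 := by
    intro t ht
    rw [← closure_Ioo hlt.ne] at ht
    exact closure_minimal (fun t ht => hz t ht) hcl ht
  refine ⟨S.V_zero hx ha hab hz', ?_⟩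
  rw [intervalIntegral.integral_congr (g := fun _ => (0:ℝ))]
  · simp
  · intro t ht
    rw [uIcc_of_le hab] at ht
    simp [hz' t ht]

structure Loc (S : QD E) (zs : E) (ℓ : E →L[ℝ] ℝ) (c Lr L ω r : ℝ) : Prop where
  hc : 0 < c
  hLr0 : 0 ≤ Lr
  hω : 0 ≤ ω
  hL0 : 0 < L
  hL : S.K * L ≤ 1 / 2
  hLγ : 1 / 2 ≤ S.γ ^ L
  hLℓ : ‖ℓ‖ * S.K * L * (2 * S.m) ≤ c / 4
  hLr : Lr * L * (2 * S.m) ≤ c / 8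
  hP : ∀ z, ‖z - zs‖ ≤ r → c ≤ ℓ (S.P z)
  hρ : ∀ z w, ‖z - zs‖ ≤ r → ‖w - zs‖ ≤ r → |S.ρ z - S.ρ w| ≤ Lr * ‖z - w‖
  hq : ∀ z, ‖z - zs‖ ≤ r → |S.q z - S.q zs - ℓ (z - zs)| ≤ ω * ‖z - zs‖

lemma QD.gain (S : QD E) {zs : E} {ℓ : E →L[ℝ] ℝ} {c Lr L ω δ W β : ℝ}
    (H : Loc S zs ℓ c Lr L ω ((2 + 4 * W) * δ))
    {ψ : E → ℝ} {x : ℝ → E} (hx : S.Sol ψ x) (hψ : ∀ z, ψ z ≤ β)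
    {a b : ℝ} (ha : 0 ≤ a) (hab : a ≤ b) (hbL : b - a ≤ L) (hxa : ‖x a - zs‖ ≤ δ)
    (hW : (‖S.f zs‖ + S.m * β) * (b - a) ≤ W * δ) :
    c / 4 * (∫ u in a..b, S.γ ^ u * ψ (x u)) - S.γ ^ a * (2 * ω * ((2 + 4 * W) * δ))
      ≤ S.V x b - S.V x a := by
  have hK := S.Kpos
  have hm := S.hm
  have hβ : 0 ≤ β := (hx.ψ0 zs).trans (hψ zs)
  have hba : 0 ≤ b - a := by linarith
  have hδ : 0 ≤ δ := (norm_nonneg _).trans hxa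
  have hWδ : 0 ≤ W * δ := le_trans (by positivity) hW
  have hKba : S.K * (b - a) ≤ 1 / 2 :=
    le_trans (mul_le_mul_of_nonneg_left hbL hK.le) H.hL
  set r := (2 + 4 * W) * δ with hr
  have hr0 : 0 ≤ r := by rw [hr]; nlinarith
  set y : ℝ → E := fun u => S.Φ (x a) (u - a) with hy
  have hyc : Continuous y := (S.Φc _).comp (continuous_id.sub continuous_const)
  have hψc : Continuous (fun t => ψ (x t)) := hx.ψc.comp hx.xc
  set I := ∫ t in a..b, ψ (x t) with hI
  have hI0 : 0 ≤ I := intervalIntegral.integral_nonneg hab (fun t _ => hx.ψ0 _)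
  have hIβ : I ≤ β * (b - a) := by
    have : I ≤ ∫ t in a..b, β := intervalIntegral.integral_mono_on hab
      (hψc.intervalIntegrable _ _) (continuous_const.intervalIntegrable _ _)
      (fun t _ => hψ _)
    simpa [mul_comm] using this
  -- nearness
  have hxn0 : ∀ u ∈ Icc a b, ‖x u - zs‖ ≤ 2 * (δ + W * δ) := by
    intro u hu
    refine (S.near hx hψ zs ha hxa hKba u hu).trans ?_
    linarith
  have hd : ∀ u ∈ Icc a b, ‖x u - y u‖ ≤ 2 * S.m * I := by
    intro u hu
    have h := S.dev (b := b) hx ha hyc (fun t ht => S.Φsd _ a t ht) (by simp [hy, S.Φ0]) u hu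
    refine h.trans ?_
    have he : Real.exp (S.K * (b - a)) ≤ 2 := by
      calc Real.exp (S.K * (b - a)) ≤ Real.exp (Real.log 2) := by
            apply Real.exp_le_exp.2; linarith [Real.log_two_gt_d9]
        _ = 2 := Real.exp_log (by norm_num)
    have h2 : 1 + S.K * (b - a) * Real.exp (S.K * (b - a)) ≤ 2 := by
      have : S.K * (b - a) * Real.exp (S.K * (b - a)) ≤ 1 / 2 * 2 := by
        gcongr
      linarith
    calc _ ≤ S.m * I * 2 := by gcongr
      _ = _ := by ring
  have hxn : ∀ u ∈ Icc a b, ‖x u - zs‖ ≤ r := fun u hu =>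
    (hxn0 u hu).trans (by rw [hr]; nlinarith)
  have hyn : ∀ u ∈ Icc a b, ‖y u - zs‖ ≤ r := by
    intro u hu
    have h1 : ‖y u - zs‖ ≤ ‖x u - zs‖ + ‖x u - y u‖ := by
      have := norm_sub_le (x u - zs) (x u - y u)
      simpa using this
    have h2 : 2 * S.m * I ≤ 2 * (W * δ) := by
      have : S.m * I ≤ S.m * (β * (b - a)) := by gcongr
      nlinarith [norm_nonneg (S.f zs)]
    have := hxn0 u hu
    have := hd u hu
    rw [hr]; nlinarith
  -- reward part
  have hga : 0 < S.γ ^ a := Real.rpow_pos_of_pos S.hγ0 a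
  have hgb : 0 < S.γ ^ b := Real.rpow_pos_of_pos S.hγ0 b
  have hgle : ∀ u, a ≤ u → S.γ ^ u ≤ S.γ ^ a := fun u hu =>
    Real.rpow_le_rpow_of_exponent_ge S.hγ0 S.hγ1.le hu
  have hrew : -(S.γ ^ a * (c / 8 * I)) ≤
      ∫ u in a..b, S.γ ^ u * (S.ρ (x u) - S.ρ (y u)) := by
    have h1 : ‖∫ u in a..b, S.γ ^ u * (S.ρ (x u) - S.ρ (y u))‖ ≤
        (S.γ ^ a * (Lr * (2 * S.m * I))) * |b - a| := by
      apply intervalIntegral.norm_integral_le_of_norm_le_const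
      intro u hu
      rw [uIoc_of_le hab] at hu
      have hu' : u ∈ Icc a b := ⟨hu.1.le, hu.2⟩
      rw [norm_mul, Real.norm_of_nonneg (Real.rpow_pos_of_pos S.hγ0 u).le, Real.norm_eq_abs]
      apply mul_le_mul (hgle u hu'.1) _ (abs_nonneg _) hga.le
      exact (H.hρ _ _ (hxn u hu') (hyn u hu')).trans
        (mul_le_mul_of_nonneg_left (hd u hu') H.hLr0)
    rw [abs_of_nonneg hba] at h1
    have h2 : (S.γ ^ a * (Lr * (2 * S.m * I))) * (b - a) ≤ S.γ ^ a * (c / 8 * I) := by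
      have h3 : Lr * (b - a) * (2 * S.m) ≤ c / 8 := by
        refine le_trans ?_ H.hLr
        have := H.hLr0
        gcongr
      calc (S.γ ^ a * (Lr * (2 * S.m * I))) * (b - a)
          = S.γ ^ a * ((Lr * (b - a) * (2 * S.m)) * I) := by ring
        _ ≤ _ := by gcongr
    have h3 := neg_abs_le (∫ u in a..b, S.γ ^ u * (S.ρ (x u) - S.ρ (y u)))
    rw [Real.norm_eq_abs] at h1
    linarith
  -- value part
  have hval : 3 / 4 * c * I - 2 * ω * r ≤ S.q (x b) - S.q (y b) := by
    have hbm : b ∈ Icc a b := ⟨hab, le_rfl⟩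
    have q1 := H.hq _ (hxn b hbm)
    have q2 := H.hq _ (hyn b hbm)
    have q1' := q1.trans (mul_le_mul_of_nonneg_left (hxn b hbm) H.hω)
    have q2' := q2.trans (mul_le_mul_of_nonneg_left (hyn b hbm) H.hω)
    rw [abs_le] at q1' q2'
    have hlin : ℓ (x b - zs) - ℓ (y b - zs) = ℓ (x b - y b) := by
      rw [← map_sub]; congr 1; abel
    have fc : Continuous S.f := S.hf.continuous
    have ii1 : IntervalIntegrable (fun u => S.f (x u)) volume a b :=
      (fc.comp hx.xc).intervalIntegrable _ _
    have ii2 : IntervalIntegrable (fun u => ψ (x u) • S.P (x u)) volume a b :=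
      (hψc.smul (S.Pc.comp hx.xc)).intervalIntegrable _ _
    have ii3 : IntervalIntegrable (fun u => S.f (y u)) volume a b :=
      (fc.comp hyc).intervalIntegrable _ _
    have hx1 : ∫ u in a..b, (S.f (x u) + ψ (x u) • S.P (x u)) = x b - x a :=
      intervalIntegral.integral_eq_sub_of_hasDeriv_right hx.xc.continuousOn
        (fun t ht => by
          rw [min_eq_left hab] at ht
          exact (hx.xd t (ha.trans ht.1.le)).mono Ioi_subset_Ici_self)
        (((fc.comp hx.xc).add (hψc.smul (S.Pc.comp hx.xc))).intervalIntegrable _ _)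
    have hy1 : ∫ u in a..b, S.f (y u) = y b - y a :=
      intervalIntegral.integral_eq_sub_of_hasDeriv_right hyc.continuousOn
        (fun t ht => by
          rw [min_eq_left hab] at ht
          exact (S.Φsd _ a t ht.1.le).mono Ioi_subset_Ici_self)
        ((fc.comp hyc).intervalIntegrable _ _)
    have hya : y a = x a := by simp [hy, S.Φ0]
    have hdec : x b - y b = (∫ u in a..b, ψ (x u) • S.P (x u))
        + ∫ u in a..b, (S.f (x u) - S.f (y u)) := by
      rw [intervalIntegral.integral_add ii1 ii2] at hx1
      rw [intervalIntegral.integral_sub ii1 ii3, hy1, hya]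
      have : x b = x a + ((∫ u in a..b, S.f (x u)) + ∫ u in a..b, ψ (x u) • S.P (x u)) := by
        rw [show (∫ u in a..b, S.f (x u)) + ∫ u in a..b, ψ (x u) • S.P (x u) = x b - x a from hx1]
        abel
      rw [this]; abel
    have hA : c * I ≤ ℓ (∫ u in a..b, ψ (x u) • S.P (x u)) := by
      rw [← ContinuousLinearMap.intervalIntegral_comp_comm ℓ ii2, hI,
        ← intervalIntegral.integral_const_mul]
      refine intervalIntegral.integral_mono_on hab
        ((hψc.const_mul c).intervalIntegrable _ _)
        ((ℓ.continuous.comp (hψc.smul (S.Pc.comp hx.xc))).intervalIntegrable _ _) ?_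
      intro u hu
      rw [map_smul, smul_eq_mul, mul_comm]
      exact mul_le_mul_of_nonneg_left (H.hP _ (hxn u hu)) (hx.ψ0 _)
    have hB : -(c / 4 * I) ≤ ℓ (∫ u in a..b, (S.f (x u) - S.f (y u))) := by
      have h1 : ‖∫ u in a..b, (S.f (x u) - S.f (y u))‖ ≤ (S.K * (2 * S.m * I)) * |b - a| := by
        apply intervalIntegral.norm_integral_le_of_norm_le_const
        intro u hu
        rw [uIoc_of_le hab] at hu
        exact (S.fl _ _).trans (mul_le_mul_of_nonneg_left (hd u ⟨hu.1.le, hu.2⟩) hK.le)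
      rw [abs_of_nonneg hba] at h1
      have h2 := (ℓ.le_opNorm (∫ u in a..b, (S.f (x u) - S.f (y u)))).trans
        (mul_le_mul_of_nonneg_left h1 (norm_nonneg ℓ))
      have h3 : ‖ℓ‖ * ((S.K * (2 * S.m * I)) * (b - a)) ≤ c / 4 * I := by
        have h4 : ‖ℓ‖ * S.K * (b - a) * (2 * S.m) ≤ c / 4 := by
          refine le_trans ?_ H.hLℓ
          gcongr
        calc ‖ℓ‖ * ((S.K * (2 * S.m * I)) * (b - a))
            = (‖ℓ‖ * S.K * (b - a) * (2 * S.m)) * I := by ring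
          _ ≤ _ := by gcongr
      rw [Real.norm_eq_abs] at h2
      have := neg_abs_le (ℓ (∫ u in a..b, (S.f (x u) - S.f (y u))))
      linarith
    have hC : ℓ (x b - y b) = ℓ (∫ u in a..b, ψ (x u) • S.P (x u))
        + ℓ (∫ u in a..b, (S.f (x u) - S.f (y u))) := by rw [hdec, map_add]
    linarith [q1'.1, q2'.2]
  have hstep := S.V_step hx.xc hab
  change S.V x b - S.V x a = (∫ u in a..b, S.γ ^ u * (S.ρ (x u) - S.ρ (y u)))
      + S.γ ^ b * (S.q (x b) - S.q (y b)) at hstep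
  rw [hstep]
  have hY : (∫ u in a..b, S.γ ^ u * ψ (x u)) ≤ S.γ ^ a * I := by
    rw [hI, ← intervalIntegral.integral_const_mul]
    refine intervalIntegral.integral_mono_on hab
      ((S.gpow_cont.mul hψc).intervalIntegrable _ _)
      ((hψc.const_mul _).intervalIntegrable _ _) (fun u hu => ?_)
    exact mul_le_mul_of_nonneg_right (hgle u hu.1) (hx.ψ0 _)
  have hgb2 : S.γ ^ a * (1 / 2) ≤ S.γ ^ b := by
    have : S.γ ^ (a + L) ≤ S.γ ^ b :=
      Real.rpow_le_rpow_of_exponent_ge S.hγ0 S.hγ1.le (by linarith)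
    rw [Real.rpow_add S.hγ0] at this
    exact le_trans (mul_le_mul_of_nonneg_left H.hLγ hga.le) this
  have hcI : 0 ≤ 3 / 4 * c * I := by have := H.hc; positivity
  have hωr : 0 ≤ 2 * ω * r := by have := H.hω; positivity
  have h5 := mul_le_mul_of_nonneg_left hval hgb.le
  have h6 := mul_le_mul_of_nonneg_right hgb2 hcI
  have h7 := mul_le_mul_of_nonneg_right (hgle b hab) hωr
  have h8 := mul_le_mul_of_nonneg_left hY (by have := H.hc; positivity : 0 ≤ c / 4)
  nlinarith

lemma QD.window (S : QD E) {zs : E} {ℓ : E →L[ℝ] ℝ} {c Lr L ω δ W β : ℝ}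
    (H : Loc S zs ℓ c Lr L ω ((2 + 4 * W) * δ)) (hδ : 0 ≤ δ) (hW0 : 0 ≤ W)
    {ψ : E → ℝ} {x : ℝ → E} (hx : S.Sol ψ x) (hψ : ∀ z, ψ z ≤ β)
    (hsupp : ∀ z, δ ≤ ‖z - zs‖ → ψ z = 0)
    (hH : ∀ a b, 0 ≤ a → a ≤ b → b - a ≤ L → ‖x a - zs‖ ≤ δ → ‖x b - zs‖ ≤ δ →
      (‖S.f zs‖ + S.m * β) * (b - a) ≤ W * δ)
    {t : ℝ} (ht : 0 ≤ t) :
    c / 4 * (∫ u in t..(t + L), S.γ ^ u * ψ (x u)) - S.γ ^ t * (2 * ω * ((2 + 4 * W) * δ))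
      ≤ S.V x (t + L) - S.V x t := by
  have hL0 := H.hL0
  have hωr : 0 ≤ 2 * ω * ((2 + 4 * W) * δ) := by have := H.hω; positivity
  have hgt : 0 < S.γ ^ t := Real.rpow_pos_of_pos S.hγ0 t
  set A : Set ℝ := Icc t (t + L) ∩ {u | ‖x u - zs‖ ≤ δ} with hA
  have hAc : IsCompact A := isCompact_Icc.inter_right
    (isClosed_le (hx.xc.sub continuous_const).norm continuous_const)
  rcases A.eq_empty_or_nonempty with he | hne
  · have hz : ∀ u ∈ Ioo t (t + L), ψ (x u) = 0 := by
      intro u hu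
      by_contra hcon
      have : u ∈ A := ⟨⟨hu.1.le, hu.2.le⟩, by
        by_contra h2
        exact hcon (hsupp _ (not_le.1 h2).le)⟩
      rw [he] at this
      exact this
    obtain ⟨h1, h2⟩ := S.V_zero' hx ht (by linarith) hz
    rw [h1, h2]
    nlinarith
  · have ha := hAc.sInf_mem hne
    have hb := hAc.sSup_mem hne
    set a := sInf A
    set b := sSup A
    have hab : a ≤ b := csInf_le hAc.bddBelow hb
    have hout : ∀ u ∈ Icc t (t + L), u ∉ A → ψ (x u) = 0 := by
      intro u hu hn
      apply hsupp
      by_contra h2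
      exact hn ⟨hu, (not_le.1 h2).le⟩
    have hta : t ≤ a := ha.1.1
    have hbt : b ≤ t + L := hb.1.2
    obtain ⟨v1, i1⟩ := S.V_zero' hx ht hta (fun u hu => hout u ⟨hu.1.le, by linarith [hu.2]⟩
      (notMem_of_lt_csInf hu.2 hAc.bddBelow))
    obtain ⟨v2, i2⟩ := S.V_zero' hx (by linarith) hbt
      (fun u hu => hout u ⟨by linarith [hu.1], hu.2.le⟩
      (notMem_of_csSup_lt hu.1 hAc.bddAbove))
    have hg := S.gain H hx hψ (ht.trans hta) hab (by linarith) ha.2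
      (hH a b (ht.trans hta) hab (by linarith) ha.2 hb.2)
    have hc : Continuous (fun u => S.γ ^ u * ψ (x u)) :=
      S.gpow_cont.mul (hx.ψc.comp hx.xc)
    have j1 := intervalIntegral.integral_add_adjacent_intervals
      (hc.intervalIntegrable (μ := volume) t a) (hc.intervalIntegrable a b)
    have j2 := intervalIntegral.integral_add_adjacent_intervals
      (hc.intervalIntegrable (μ := volume) t b) (hc.intervalIntegrable b (t + L))
    rw [← j2, ← j1, i1, i2, v2, ← v1]
    have : S.γ ^ a ≤ S.γ ^ t := Real.rpow_le_rpow_of_exponent_ge S.hγ0 S.hγ1.le hta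
    have := mul_le_mul_of_nonneg_right this hωr
    simp only [zero_add, add_zero]
    linarith

lemma QD.lower (S : QD E) {z0 zs : E} {L δ β T τ c1 c2 c3 : ℝ}
    (hT : 0 ≤ T) (hzs : S.Φ z0 T = zs) (hδ : 0 < δ)
    {ψ : E → ℝ} {x : ℝ → E} (hx : S.Sol ψ x) (hψ : ∀ z, ψ z ≤ β) (hx0 : x 0 = z0)
    (hplat : ∀ z, ‖z - zs‖ ≤ δ / 2 → ψ z = β)
    (hL : S.K * L ≤ 1 / 2) (hτ0 : 0 ≤ τ) (hτL : τ ≤ L)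
    (hWτ : (‖S.f zs‖ + S.m * β) * τ ≤ δ / 8) (hβτ : c3 * δ ≤ β * τ)
    (hc1 : S.m * (1 + S.K * T * Real.exp (S.K * T)) * c1 ≤ 1 / 8) (h21 : c2 ≤ c1) (h23 : c2 ≤ c3) :
    c2 * δ ≤ ∫ u in (0:ℝ)..(T + L), ψ (x u) := by
  have hψc : Continuous (fun t => ψ (x t)) := hx.ψc.comp hx.xc
  have hK := S.Kpos
  have hm := S.hm
  have mono : ∀ a b, 0 ≤ a → a ≤ b → b ≤ T + L →
      ∫ u in a..b, ψ (x u) ≤ ∫ u in (0:ℝ)..(T + L), ψ (x u) := fun a b h0 h1 h2 =>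
    intervalIntegral.integral_mono_interval h0 h1 h2
      (ae_of_all _ fun t => hx.ψ0 _) (hψc.intervalIntegrable _ _)
  by_cases hcase : c1 * δ ≤ ∫ u in (0:ℝ)..T, ψ (x u)
  · have := mono 0 T le_rfl hT (by linarith)
    nlinarith
  push Not at hcase
  have hd := S.dev (b := T) hx le_rfl (S.Φc z0) (fun t ht => S.Φd z0 t ht)
    (by rw [hx0, S.Φ0]) T ⟨hT, le_rfl⟩
  rw [hzs, sub_zero] at hd
  have hnear : ‖x T - zs‖ ≤ δ / 8 := by
    refine hd.trans ?_
    set A := 1 + S.K * T * Real.exp (S.K * T) with hA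
    have hA0 : 0 ≤ A := by rw [hA]; positivity
    calc S.m * (∫ u in (0:ℝ)..T, ψ (x u)) * A ≤ S.m * (c1 * δ) * A := by gcongr
      _ = (S.m * A * c1) * δ := by ring
      _ ≤ 1 / 8 * δ := by gcongr
      _ = δ / 8 := by ring
  have hKτ : S.K * (T + τ - T) ≤ 1 / 2 := by
    rw [add_sub_cancel_left]
    exact (mul_le_mul_of_nonneg_left hτL hK.le).trans hL
  have hn := S.near (b := T + τ) hx hψ zs hT hnear hKτ
  rw [add_sub_cancel_left] at hn
  have h1 : ∫ u in T..(T + τ), ψ (x u) = β * τ := by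
    rw [intervalIntegral.integral_congr (g := fun _ => β)]
    · simp [mul_comm]
    · intro u hu
      rw [uIcc_of_le (by linarith)] at hu
      exact hplat _ ((hn u hu).trans (by linarith))
  have := mono T (T + τ) hT (by linarith) (by linarith)
  nlinarith

lemma QD.win (S : QD E) {z0 zs : E} {ℓ : E →L[ℝ] ℝ} {c Lr L ω δ W β T τ c1 c2 c3 : ℝ}
    (H : Loc S zs ℓ c Lr L ω ((2 + 4 * W) * δ)) (hδ : 0 < δ) (hW0 : 0 ≤ W)
    (hT : 0 ≤ T) (hzs : S.Φ z0 T = zs)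
    {ψ : E → ℝ} {x : ℝ → E} (hx : S.Sol ψ x) (hψ : ∀ z, ψ z ≤ β) (hx0 : x 0 = z0)
    (hsupp : ∀ z, δ ≤ ‖z - zs‖ → ψ z = 0)
    (hplat : ∀ z, ‖z - zs‖ ≤ δ / 2 → ψ z = β)
    (hH : ∀ a b, 0 ≤ a → a ≤ b → b - a ≤ L → ‖x a - zs‖ ≤ δ → ‖x b - zs‖ ≤ δ →
      (‖S.f zs‖ + S.m * β) * (b - a) ≤ W * δ)
    (hτ0 : 0 ≤ τ) (hτL : τ ≤ L)
    (hWτ : (‖S.f zs‖ + S.m * β) * τ ≤ δ / 8) (hβτ : c3 * δ ≤ β * τ)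
    (hc1 : S.m * (1 + S.K * T * Real.exp (S.K * T)) * c1 ≤ 1 / 8) (h21 : c2 ≤ c1) (h23 : c2 ≤ c3)
    (hfin : 2 * ω * (2 + 4 * W) / (1 - S.γ ^ L) < c / 4 * (S.γ ^ (T + L) * c2)) :
    S.q z0 < S.J x := by
  have hL0 := H.hL0
  have hlow := S.lower hT hzs hδ hx hψ hx0 hplat H.hL hτ0 hτL hWτ hβτ hc1 h21 h23
  have hψc : Continuous (fun t => ψ (x t)) := hx.ψc.comp hx.xc
  have hc : Continuous (fun u => S.γ ^ u * ψ (x u)) := S.gpow_cont.mul hψc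
  set g := S.γ ^ L with hg
  have hg1 : g < 1 := Real.rpow_lt_one S.hγ0.le S.hγ1 hL0
  have hg0 : 0 < g := Real.rpow_pos_of_pos S.hγ0 L
  set e := 2 * ω * ((2 + 4 * W) * δ) with he
  have he0 : 0 ≤ e := by have := H.hω; rw [he]; positivity
  have hV0 : S.V x 0 = S.q z0 := by simp [QD.V, hx0]
  have ind : ∀ N : ℕ, c / 4 * (∫ u in (0:ℝ)..(N * L), S.γ ^ u * ψ (x u))
      - e * ((1 - g ^ N) / (1 - g)) ≤ S.V x (N * L) - S.V x 0 := by
    intro N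
    induction N with
    | zero => simp
    | succ N ih =>
      have hw := S.window H hδ.le hW0 hx hψ hsupp hH (t := N * L) (by positivity)
      have j := intervalIntegral.integral_add_adjacent_intervals
        (hc.intervalIntegrable (μ := volume) 0 (N * L)) (hc.intervalIntegrable (N * L) (N * L + L))
      have e1 : ((N + 1 : ℕ) : ℝ) * L = N * L + L := by push_cast; ring
      have e2 : S.γ ^ ((N : ℝ) * L) = g ^ N := by
        rw [hg, mul_comm, Real.rpow_mul S.hγ0.le, Real.rpow_natCast]
      rw [e1, ← j]
      rw [e2] at hw
      have e3 : (1 - g ^ (N + 1)) / (1 - g) = (1 - g ^ N) / (1 - g) + g ^ N := by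
        have : 1 - g ≠ 0 := by linarith
        field_simp; ring
      rw [e3]
      nlinarith
  have hmain : ∀ N : ℕ, T + L ≤ N * L →
      S.q z0 + (c / 4 * (S.γ ^ (T + L) * (c2 * δ)) - e / (1 - g)) ≤ S.V x (N * L) := by
    intro N hN
    have h1 := ind N
    rw [hV0] at h1
    have h2 : e * ((1 - g ^ N) / (1 - g)) ≤ e / (1 - g) := by
      rw [mul_div_assoc']
      have : 0 < 1 - g := by linarith
      have : 0 < g ^ N := by positivity
      gcongr
      nlinarith
    have hTL : 0 ≤ T + L := by linarith
    have h3 : S.γ ^ (T + L) * (c2 * δ) ≤ ∫ u in (0:ℝ)..(N * L), S.γ ^ u * ψ (x u) := by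
      calc S.γ ^ (T + L) * (c2 * δ) ≤ S.γ ^ (T + L) * ∫ u in (0:ℝ)..(T + L), ψ (x u) :=
            mul_le_mul_of_nonneg_left hlow (Real.rpow_pos_of_pos S.hγ0 _).le
        _ = ∫ u in (0:ℝ)..(T + L), S.γ ^ (T + L) * ψ (x u) :=
            (intervalIntegral.integral_const_mul _ _).symm
        _ ≤ ∫ u in (0:ℝ)..(T + L), S.γ ^ u * ψ (x u) := by
            refine intervalIntegral.integral_mono_on hTL
              ((hψc.const_mul _).intervalIntegrable _ _) (hc.intervalIntegrable _ _)
              (fun u hu => ?_)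
            exact mul_le_mul_of_nonneg_right
              (Real.rpow_le_rpow_of_exponent_ge S.hγ0 S.hγ1.le hu.2) (hx.ψ0 _)
        _ ≤ _ := intervalIntegral.integral_mono_interval le_rfl hTL hN
            (ae_of_all _ fun t => mul_nonneg (Real.rpow_pos_of_pos S.hγ0 _).le (hx.ψ0 _))
            (hc.intervalIntegrable _ _)
    have h4 := mul_le_mul_of_nonneg_left h3 (by have := H.hc; positivity : 0 ≤ c / 4)
    linarith
  have hlim : Tendsto (fun N : ℕ => S.V x (N * L)) atTop (𝓝 (S.J x)) :=
    (S.V_tendsto hx.xc).comp (tendsto_natCast_atTop_atTop.atTop_mul_const hL0)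
  have hge : S.q z0 + (c / 4 * (S.γ ^ (T + L) * (c2 * δ)) - e / (1 - g)) ≤ S.J x := by
    refine ge_of_tendsto hlim ?_
    have h5 : ∀ᶠ N : ℕ in atTop, T + L ≤ N * L :=
      (tendsto_natCast_atTop_atTop.atTop_mul_const hL0).eventually_ge_atTop _
    filter_upwards [h5] with N hN using hmain N hN
  have h6 := mul_lt_mul_of_pos_right hfin hδ
  have h7 : 2 * ω * (2 + 4 * W) / (1 - g) * δ = e / (1 - g) := by rw [he]; ring
  rw [h7] at h6
  nlinarith

lemma QD.evL (S : QD E) (ℓ : E →L[ℝ] ℝ) {c Lr : ℝ} (hc : 0 < c) :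
    ∀ᶠ L : ℝ in 𝓝[>] (0:ℝ), 0 < L ∧ (S.K : ℝ) * L ≤ 1 / 2 ∧ 1 / 2 ≤ S.γ ^ L ∧
      ‖ℓ‖ * S.K * L * (2 * S.m) ≤ c / 4 ∧ Lr * L * (2 * S.m) ≤ c / 8 := by
  have h1 : ∀ᶠ L : ℝ in 𝓝 (0:ℝ), (S.K : ℝ) * L < 1 / 2 :=
    (Continuous.tendsto' (by fun_prop : Continuous fun L : ℝ => (S.K : ℝ) * L) 0 0 (by simp)).eventually_lt_const
      (by norm_num)
  have h2 : ∀ᶠ L in 𝓝 (0:ℝ), 1 / 2 < S.γ ^ L :=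
    (Continuous.tendsto' S.gpow_cont 0 1 (by simp)).eventually_const_lt (by norm_num)
  have h3 : ∀ᶠ L in 𝓝 (0:ℝ), ‖ℓ‖ * S.K * L * (2 * S.m) < c / 4 :=
    (Continuous.tendsto' (by fun_prop : Continuous fun L : ℝ => ‖ℓ‖ * S.K * L * (2 * S.m)) 0 0
      (by simp)).eventually_lt_const (by positivity)
  have h4 : ∀ᶠ L in 𝓝 (0:ℝ), Lr * L * (2 * S.m) < c / 8 :=
    (Continuous.tendsto' (by fun_prop : Continuous fun L : ℝ => Lr * L * (2 * S.m)) 0 0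
      (by simp)).eventually_lt_const (by positivity)
  filter_upwards [self_mem_nhdsWithin, nhdsWithin_le_nhds h1, nhdsWithin_le_nhds h2,
    nhdsWithin_le_nhds h3, nhdsWithin_le_nhds h4] with L a1 a2 a3 a4 a5
  exact ⟨a1, a2.le, a3.le, a4.le, a5.le⟩

lemma QD.mkloc (S : QD E) {zs : E} {ℓ : E →L[ℝ] ℝ} (hℓ : HasFDerivAt S.q ℓ zs)
    (hpos : 0 < ℓ (S.P zs)) {Lr r1 : ℝ} (hLr0 : 0 ≤ Lr) (hr1 : 0 < r1)
    (hρ : ∀ z w, ‖z - zs‖ ≤ r1 → ‖w - zs‖ ≤ r1 → |S.ρ z - S.ρ w| ≤ Lr * ‖z - w‖)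
    {L ω : ℝ} (hω : 0 < ω)
    (hL : 0 < L ∧ (S.K : ℝ) * L ≤ 1 / 2 ∧ 1 / 2 ≤ S.γ ^ L ∧
      ‖ℓ‖ * S.K * L * (2 * S.m) ≤ ℓ (S.P zs) / 2 / 4 ∧ Lr * L * (2 * S.m) ≤ ℓ (S.P zs) / 2 / 8) :
    ∃ r0 > 0, ∀ r ≤ r0, Loc S zs ℓ (ℓ (S.P zs) / 2) Lr L ω r := by
  have e1 : ∀ᶠ z in 𝓝 zs, ℓ (S.P zs) / 2 < ℓ (S.P z) :=
    (ℓ.continuous.comp S.Pc).continuousAt.eventually_const_lt (by simp; linarith)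
  have e2 : ∀ᶠ z in 𝓝 zs, ‖S.q z - S.q zs - ℓ (z - zs)‖ ≤ ω * ‖z - zs‖ :=
    hℓ.isLittleO.def hω
  obtain ⟨r2, hr2, h2⟩ := Metric.eventually_nhds_iff.1 (e1.and e2)
  refine ⟨min r1 (r2 / 2), by positivity, fun r hr => ?_⟩
  have k1 : r ≤ r1 := hr.trans (min_le_left _ _)
  have k2 : r < r2 := lt_of_le_of_lt (hr.trans (min_le_right _ _)) (by linarith)
  obtain ⟨l1, l2, l3, l4, l5⟩ := hL
  refine ⟨by positivity, hLr0, hω.le, l1, l2, l3, l4, l5, fun z hz => ?_,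
    fun z w hz hw => hρ z w (hz.trans k1) (hw.trans k1), fun z hz => ?_⟩
  · exact (h2 (by rw [dist_eq_norm]; linarith)).1.le
  · exact (h2 (by rw [dist_eq_norm]; linarith)).2

lemma QD.exω (S : QD E) {c W L T c2 : ℝ} (hc : 0 < c) (_hL : 0 < L) (hc2 : 0 < c2) :
    ∃ ω > 0, 2 * ω * (2 + 4 * W) / (1 - S.γ ^ L) < c / 4 * (S.γ ^ (T + L) * c2) := by
  have hp : 0 < c / 4 * (S.γ ^ (T + L) * c2) := by
    have := Real.rpow_pos_of_pos S.hγ0 (T + L)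
    positivity
  have h1 : ∀ᶠ ω in 𝓝 (0:ℝ),
      2 * ω * (2 + 4 * W) / (1 - S.γ ^ L) < c / 4 * (S.γ ^ (T + L) * c2) :=
    (Continuous.tendsto' (by fun_prop :
      Continuous fun ω : ℝ => 2 * ω * (2 + 4 * W) / (1 - S.γ ^ L)) 0 0
      (by simp)).eventually_lt_const hp
  have h2 : ∀ᶠ ω in 𝓝[>] (0:ℝ), 0 < ω := self_mem_nhdsWithin
  obtain ⟨ω, h3, h4⟩ := (h2.and (nhdsWithin_le_nhds h1)).exists
  exact ⟨ω, h3, h4⟩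

lemma QD.core (S : QD E) {z0 zs : E} {T : ℝ} (hT : 0 ≤ T) (hzs : S.Φ z0 T = zs)
    {ℓ : E →L[ℝ] ℝ} (hℓ : HasFDerivAt S.q ℓ zs)
    (hpos : 0 < ℓ (S.P zs)) {Lr r1 : ℝ} (hLr0 : 0 ≤ Lr) (hr1 : 0 < r1)
    (hρ : ∀ z w, ‖z - zs‖ ≤ r1 → ‖w - zs‖ ≤ r1 → |S.ρ z - S.ρ w| ≤ Lr * ‖z - w‖) :
    ∃ δ > 0, ∃ β, 0 < β ∧ β ≤ 1 ∧ ∀ (ψ : E → ℝ) (x : ℝ → E), S.Sol ψ x → (∀ z, ψ z ≤ β) →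
      x 0 = z0 → (∀ z, δ ≤ ‖z - zs‖ → ψ z = 0) → (∀ z, ‖z - zs‖ ≤ δ / 2 → ψ z = β) →
      S.q z0 < S.J x := by
  have hK := S.Kpos
  have hm := S.hm
  have hc : 0 < ℓ (S.P zs) / 2 := by positivity
  have hA : 0 < S.m * (1 + S.K * T * Real.exp (S.K * T)) := by positivity
  obtain ⟨c1, hc1⟩ : ∃ c1, c1 = 1 / (8 * (S.m * (1 + S.K * T * Real.exp (S.K * T)))) := ⟨_, rfl⟩
  have hc10 : 0 < c1 := by rw [hc1]; positivity
  have hc1' : S.m * (1 + S.K * T * Real.exp (S.K * T)) * c1 ≤ 1 / 8 := by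
    rw [hc1]; apply le_of_eq; field_simp
  rcases eq_or_ne (S.f zs) 0 with h0 | hn0
  · obtain ⟨L, hL⟩ := (S.evL ℓ (Lr := Lr) hc).exists
    have hL0 := hL.1
    obtain ⟨τ, hτ⟩ : ∃ τ, τ = min L (1 / (8 * S.m)) := ⟨_, rfl⟩
    have hτ0 : 0 < τ := by rw [hτ]; positivity
    have hτ2 : S.m * τ ≤ 1 / 8 := by
      calc S.m * τ ≤ S.m * (1 / (8 * S.m)) := by rw [hτ]; gcongr; exact min_le_right _ _
        _ = 1 / 8 := by field_simp
    have hτL : τ ≤ L := by rw [hτ]; exact min_le_left _ _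
    obtain ⟨ω, hω, hfin⟩ := S.exω (W := S.m * L) (T := T) hc hL0
      (lt_min hc10 hτ0 : 0 < min c1 τ)
    obtain ⟨r0, hr0, hloc⟩ := S.mkloc hℓ hpos hLr0 hr1 hρ hω hL
    have hR : 0 < 2 + 4 * (S.m * L) := by positivity
    have hδ0 : 0 < min 1 (r0 / (2 + 4 * (S.m * L))) := by positivity
    obtain ⟨δ, hδ⟩ : ∃ δ, δ = min 1 (r0 / (2 + 4 * (S.m * L))) := ⟨_, rfl⟩
    rw [← hδ] at hδ0
    have hδ1 : δ ≤ 1 := by rw [hδ]; exact min_le_left _ _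
    have hδ2 : (2 + 4 * (S.m * L)) * δ ≤ r0 := by
      have : δ ≤ r0 / (2 + 4 * (S.m * L)) := by rw [hδ]; exact min_le_right _ _
      rw [le_div_iff₀ hR] at this
      linarith
    refine ⟨δ, hδ0, δ, hδ0, hδ1, fun ψ x hx hψ hx0 hs hp => ?_⟩
    refine S.win (hloc _ hδ2) hδ0 (by positivity) hT hzs hx hψ hx0 hs hp ?_ hτ0.le hτL
      ?_ (c3 := τ) (by linarith) hc1' (min_le_left _ _) (min_le_right _ _) hfin
    · intro a b _ _ hab _ _
      rw [h0, norm_zero, zero_add]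
      calc S.m * δ * (b - a) ≤ S.m * δ * L := by gcongr
        _ = _ := by ring
    · rw [h0, norm_zero, zero_add]
      nlinarith
  · have hn : 0 < ‖S.f zs‖ := norm_pos_iff.2 hn0
    obtain ⟨n, hnn⟩ : ∃ n, n = ‖S.f zs‖ := ⟨_, rfl⟩
    rw [← hnn] at hn
    obtain ⟨β, hβ⟩ : ∃ β, β = min 1 (n / (4 * S.m)) := ⟨_, rfl⟩
    have hβ0 : 0 < β := by rw [hβ]; positivity
    have hβ1 : β ≤ 1 := by rw [hβ]; exact min_le_left _ _
    have hβ2 : S.m * β ≤ n / 4 := by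
      calc S.m * β ≤ S.m * (n / (4 * S.m)) := by rw [hβ]; gcongr; exact min_le_right _ _
        _ = n / 4 := by field_simp
    obtain ⟨W', hW'⟩ : ∃ W', W' = n + S.m * β := ⟨_, rfl⟩
    have hW'0 : 0 < W' := by rw [hW']; positivity
    obtain ⟨ρ0, hρ0⟩ : ∃ ρ0, ρ0 = n / (4 * S.K) := ⟨_, rfl⟩
    have hρ00 : 0 < ρ0 := by rw [hρ0]; positivity
    have hKρ : S.K * ρ0 = n / 4 := by rw [hρ0]; field_simp
    have hev : ∀ᶠ L in 𝓝 (0:ℝ), W' * L < ρ0 / 4 :=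
      (Continuous.tendsto' (by fun_prop : Continuous fun L : ℝ => W' * L) 0 0
        (by simp)).eventually_lt_const (by positivity)
    obtain ⟨L, hL, hLW⟩ := ((S.evL ℓ (Lr := Lr) hc).and (nhdsWithin_le_nhds hev)).exists
    have hL0 := hL.1
    obtain ⟨W, hW⟩ : ∃ W, W = 4 * W' / n := ⟨_, rfl⟩
    have hW0 : 0 < W := by rw [hW]; positivity
    have hc30 : 0 < β / (8 * W') := by positivity
    obtain ⟨ω, hω, hfin⟩ := S.exω (W := W) (T := T) hc hL0
      (lt_min hc10 hc30 : 0 < min c1 (β / (8 * W')))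
    obtain ⟨r0, hr0, hloc⟩ := S.mkloc hℓ hpos hLr0 hr1 hρ hω hL
    have hR : 0 < 2 + 4 * W := by positivity
    obtain ⟨δ, hδ⟩ : ∃ δ, δ = min (min (ρ0 / 4) (8 * W' * L)) (r0 / (2 + 4 * W)) := ⟨_, rfl⟩
    have hδ0 : 0 < δ := by rw [hδ]; positivity
    have hδ1 : δ ≤ ρ0 / 4 := by rw [hδ]; exact (min_le_left _ _).trans (min_le_left _ _)
    have hδ3 : δ ≤ 8 * W' * L := by rw [hδ]; exact (min_le_left _ _).trans (min_le_right _ _)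
    have hδ2 : (2 + 4 * W) * δ ≤ r0 := by
      have : δ ≤ r0 / (2 + 4 * W) := by rw [hδ]; exact min_le_right _ _
      rw [le_div_iff₀ hR] at this
      linarith
    refine ⟨δ, hδ0, β, hβ0, hβ1, fun ψ x hx hψ hx0 hs hp => ?_⟩
    refine S.win (τ := δ / (8 * W')) (hloc _ hδ2) hδ0 hW0.le hT hzs hx hψ hx0 hs hp ?_
      (by positivity) (by rw [div_le_iff₀ (by positivity)]; linarith)
      ?_ (c3 := β / (8 * W')) (le_of_eq (by ring)) hc1' (min_le_left _ _) (min_le_right _ _) hfin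
    · intro a b ha hab hbL hxa hxb
      rw [← hnn, ← hW']
      have hKba : S.K * (b - a) ≤ 1 / 2 :=
        le_trans (mul_le_mul_of_nonneg_left hbL hK.le) hL.2.1
      have hnear := S.near hx hψ zs ha hxa hKba
      rw [← hnn, ← hW'] at hnear
      have hseg := norm_image_sub_le_of_norm_deriv_right_le_segment
        (f := fun t => x t - (t - a) • S.f zs)
        (f' := fun t => (S.f (x t) + ψ (x t) • S.P (x t)) - (1:ℝ) • S.f zs) (a := a) (b := b)
        (C := n / 2)
        (hx.xc.sub ((continuous_id.sub continuous_const).smul continuous_const)).continuousOn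
        (fun t ht => (hx.xd t (ha.trans ht.1)).sub
          (((hasDerivAt_id t).sub_const a).smul_const (S.f zs)).hasDerivWithinAt)
        (fun t ht => by
          have hb2 : ‖x t - zs‖ ≤ ρ0 := by
            refine (hnear t ⟨ht.1, ht.2.le⟩).trans ?_
            have : W' * (b - a) ≤ W' * L := by gcongr
            linarith
          have e : (S.f (x t) + ψ (x t) • S.P (x t)) - (1:ℝ) • S.f zs
            = (S.f (x t) - S.f zs) + ψ (x t) • S.P (x t) := by rw [one_smul]; abel
          rw [e]
          refine (norm_add_le _ _).trans ?_
          have h1 := (S.fl (x t) zs).trans (mul_le_mul_of_nonneg_left hb2 hK.le)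
          have h2 : ‖ψ (x t) • S.P (x t)‖ ≤ S.m * β := by
            rw [norm_smul, Real.norm_of_nonneg (hx.ψ0 _), mul_comm]
            exact mul_le_mul (S.Pm _) (hψ _) (hx.ψ0 _) S.hm.le
          linarith) b ⟨hab, le_rfl⟩
      have hba : 0 ≤ b - a := by linarith
      have h5 : ‖(b - a) • S.f zs‖ = (b - a) * n := by
        rw [norm_smul, Real.norm_of_nonneg hba, ← hnn]
      have h6 : (b - a) • S.f zs = (x b - zs) - (x a - zs)
          - ((x b - (b - a) • S.f zs) - (x a - (a - a) • S.f zs)) := by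
        simp
      have h7 : ‖(b - a) • S.f zs‖ ≤ δ + δ + n / 2 * (b - a) := by
        rw [h6]
        refine (norm_sub_le _ _).trans (add_le_add ((norm_sub_le _ _).trans ?_) hseg)
        linarith
      rw [h5] at h7
      have h8 : (b - a) * n ≤ 4 * δ := by linarith
      have h9 : (b - a) ≤ 4 * δ / n := by rw [le_div_iff₀ hn]; exact h8
      calc W' * (b - a) ≤ W' * (4 * δ / n) := by gcongr
        _ = W * δ := by rw [hW]; ring
    · rw [← hnn, ← hW']
      apply le_of_eq; field_simp

end QSMaux

namespace QSMaux
open Filter Topology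

lemma ext_right {E : Type*} [NormedAddCommGroup E] [NormedSpace ℝ E] {g g' : ℝ → E}
    (h : ∀ t, 0 ≤ t → HasDerivAt g (g' t) t) :
    Continuous (fun t => g (max t 0)) ∧
    ∀ t, 0 ≤ t → HasDerivWithinAt (fun u => g (max u 0)) (g' t) (Ici t) t := by
  constructor
  · have h1 : ContinuousOn g (Ici 0) := fun t ht => (h t ht).continuousAt.continuousWithinAt
    exact h1.comp_continuous (continuous_id.max continuous_const) (fun t => by simp)
  · intro t ht
    refine (h t ht).hasDerivWithinAt.congr (fun u hu => ?_) ?_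
    · have : 0 ≤ u := ht.trans hu
      simp [this]
    · simp [ht]

end QSMaux

/-- optimality condition at an arbitrary initial condition: if `Ψ*`
maximizes `J(Ψ) = Q^Ψ(s₀,a₀)` over the class of smooth `C`-bounded Lipschitz vector
fields, then along the trajectory of the `Ψ*`-dynamics started at `(s₀,a₀)`, wherever
`∇ₐQ^{Ψ*}(s,a) ≠ 0` the score is positively proportional to it:
`Ψ*(s,a) = α_{s,a}·∇ₐQ^{Ψ*}(s,a)` for some `α_{s,a} > 0`. -/
theorem qsm_stmt7 {ns na : ℕ} (γ C : ℝ) (hγ : γ ∈ Set.Ioo (0:ℝ) 1) (hC : 0 < C)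
    (F : EuclideanSpace ℝ (Fin ns) → EuclideanSpace ℝ (Fin na) → EuclideanSpace ℝ (Fin ns))
    (hF : ∃ K : NNReal, LipschitzWith K
      (fun p : EuclideanSpace ℝ (Fin ns) × EuclideanSpace ℝ (Fin na) => F p.1 p.2))
    (r : EuclideanSpace ℝ (Fin ns) → ℝ)
    (hrsmooth : ContDiff ℝ (⊤ : ℕ∞) r) (hr01 : ∀ x, r x ∈ Set.Icc (0:ℝ) 1)
    -- the solution map of the joint dynamics, for each admissible vector field
    (st : (EuclideanSpace ℝ (Fin ns) → EuclideanSpace ℝ (Fin na) →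
        EuclideanSpace ℝ (Fin na)) →
      EuclideanSpace ℝ (Fin ns) → EuclideanSpace ℝ (Fin na) → ℝ →
      EuclideanSpace ℝ (Fin ns))
    (ac : (EuclideanSpace ℝ (Fin ns) → EuclideanSpace ℝ (Fin na) →
        EuclideanSpace ℝ (Fin na)) →
      EuclideanSpace ℝ (Fin ns) → EuclideanSpace ℝ (Fin na) → ℝ →
      EuclideanSpace ℝ (Fin na))
    (hinit : ∀ Ψ, QSM.Admissible C Ψ → ∀ s₀ a₀,
      st Ψ s₀ a₀ 0 = s₀ ∧ ac Ψ s₀ a₀ 0 = a₀)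
    (hODE : ∀ Ψ, QSM.Admissible C Ψ → ∀ s₀ a₀, ∀ t : ℝ, 0 ≤ t →
      HasDerivAt (st Ψ s₀ a₀) (F (st Ψ s₀ a₀ t) (ac Ψ s₀ a₀ t)) t ∧
      HasDerivAt (ac Ψ s₀ a₀) (Ψ (st Ψ s₀ a₀ t) (ac Ψ s₀ a₀ t)) t)
    -- the Q-function of each admissible vector field
    (Q : (EuclideanSpace ℝ (Fin ns) → EuclideanSpace ℝ (Fin na) →
        EuclideanSpace ℝ (Fin na)) →
      EuclideanSpace ℝ (Fin ns) → EuclideanSpace ℝ (Fin na) → ℝ)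
    (hQ : ∀ Ψ s₀ a₀, Q Ψ s₀ a₀ = ∫ t in Set.Ioi (0:ℝ), γ ^ t * r (st Ψ s₀ a₀ t))
    -- an arbitrary fixed initial condition
    (s₀ : EuclideanSpace ℝ (Fin ns)) (a₀ : EuclideanSpace ℝ (Fin na))
    -- the maximizer Ψ*
    (Ψstar : EuclideanSpace ℝ (Fin ns) → EuclideanSpace ℝ (Fin na) →
      EuclideanSpace ℝ (Fin na))
    (hstar : QSM.Admissible C Ψstar)
    (hmax : ∀ Ψ, QSM.Admissible C Ψ → Q Ψ s₀ a₀ ≤ Q Ψstar s₀ a₀)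
    -- Q^{Ψ*} is differentiable along the trajectory started at the origin
    (hdiff : ∀ t : ℝ, 0 ≤ t → DifferentiableAt ℝ
      (fun p : EuclideanSpace ℝ (Fin ns) × EuclideanSpace ℝ (Fin na) => Q Ψstar p.1 p.2)
      (st Ψstar s₀ a₀ t, ac Ψstar s₀ a₀ t)) :
    ∀ t : ℝ, 0 ≤ t →
      gradient (fun a' => Q Ψstar (st Ψstar s₀ a₀ t) a') (ac Ψstar s₀ a₀ t) ≠ 0 →
      ∃ α : ℝ, 0 < α ∧
        Ψstar (st Ψstar s₀ a₀ t) (ac Ψstar s₀ a₀ t) =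
          α • gradient (fun a' => Q Ψstar (st Ψstar s₀ a₀ t) a') (ac Ψstar s₀ a₀ t) := by
  intro T hT hG
  set zs : EuclideanSpace ℝ (Fin ns) × EuclideanSpace ℝ (Fin na) :=
    (st Ψstar s₀ a₀ T, ac Ψstar s₀ a₀ T) with hzs
  set G := gradient (fun a' => Q Ψstar (st Ψstar s₀ a₀ T) a') (ac Ψstar s₀ a₀ T) with hGdef
  have hGn : 0 < ‖G‖ := norm_pos_iff.2 hG
  set v := (C / ‖G‖) • G with hv
  have hvn : ‖v‖ = C := by
    rw [hv, norm_smul, Real.norm_of_nonneg (by positivity)]; field_simp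
  refine ⟨C / ‖G‖, by positivity, ?_⟩
  change Ψstar zs.1 zs.2 = v
  by_contra hne
  obtain ⟨KF, hKF⟩ := hF
  obtain ⟨hsm, ⟨KΨ, hKΨ⟩, hbd⟩ := id hstar
  -- directional positivity
  have hinn : 0 < inner ℝ G (v - Ψstar zs.1 zs.2) := by
    by_contra hcon
    push Not at hcon
    have h1 : inner ℝ v (v - Ψstar zs.1 zs.2) ≤ 0 := by
      rw [hv, real_inner_smul_left, ← hv]
      exact mul_nonpos_of_nonneg_of_nonpos (by positivity) hcon
    have h2 := norm_sub_sq_real v (Ψstar zs.1 zs.2)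
    rw [inner_sub_right, real_inner_self_eq_norm_sq] at h1
    have h3 := hbd zs.1 zs.2
    have h4 : ‖Ψstar zs.1 zs.2‖ ^ 2 ≤ C ^ 2 := by gcongr
    rw [hvn] at h1 h2
    have h5 : ‖v - Ψstar zs.1 zs.2‖ ^ 2 ≤ 0 := by linarith
    have h6 : ‖v - Ψstar zs.1 zs.2‖ = 0 := by
      have := sq_nonneg ‖v - Ψstar zs.1 zs.2‖
      exact pow_eq_zero_iff (two_ne_zero) |>.1 (le_antisymm h5 this)
    exact hne (sub_eq_zero.1 (norm_eq_zero.1 h6)).symm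
  let S : QSMaux.QD (EuclideanSpace ℝ (Fin ns) × EuclideanSpace ℝ (Fin na)) :=
    { γ := γ
      K := max KF KΨ + 1
      m := 2 * C
      f := fun p => (F p.1 p.2, Ψstar p.1 p.2)
      Φ := fun p t => (st Ψstar p.1 p.2 (max t 0), ac Ψstar p.1 p.2 (max t 0))
      ρ := fun p => r p.1
      P := fun p => (0, v - Ψstar p.1 p.2)
      hγ0 := hγ.1
      hγ1 := hγ.2
      hK := by positivity
      hm := by positivity
      hf := (hKF.prodMk hKΨ).weaken (by simp)
      Φc := fun p => (QSMaux.ext_right fun t ht => (hODE Ψstar hstar p.1 p.2 t ht).1).1.prodMk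
        (QSMaux.ext_right fun t ht => (hODE Ψstar hstar p.1 p.2 t ht).2).1
      Φ0 := fun p => by
        have := hinit Ψstar hstar p.1 p.2
        simp [this.1, this.2]
      Φd := fun p t ht => by
        have h1 := (QSMaux.ext_right fun t ht => (hODE Ψstar hstar p.1 p.2 t ht).1).2 t ht
        have h2 := (QSMaux.ext_right fun t ht => (hODE Ψstar hstar p.1 p.2 t ht).2).2 t ht
        have h3 := h1.prodMk h2
        simpa [max_eq_left ht] using h3
      ρc := hrsmooth.continuous.comp continuous_fst
      ρ0 := fun z => (hr01 _).1
      ρ1 := fun z => (hr01 _).2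
      Pc := continuous_const.prodMk (continuous_const.sub hsm.continuous)
      Pm := fun z => by
        rw [Prod.norm_mk, norm_zero, max_eq_right (norm_nonneg _)]
        refine (norm_sub_le _ _).trans ?_
        have := hbd z.1 z.2
        rw [hvn]; linarith }
  have hJ : ∀ Ψ s a, S.J (fun t => (st Ψ s a (max t 0), ac Ψ s a (max t 0))) = Q Ψ s a := by
    intro Ψ s a
    rw [hQ]
    refine setIntegral_congr_fun measurableSet_Ioi fun t ht => ?_
    have : max t 0 = t := max_eq_left (le_of_lt ht)
    show γ ^ t * r (st Ψ s a (max t 0)) = _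
    rw [this]
  have hq : S.q = fun p => Q Ψstar p.1 p.2 := by
    funext p
    exact hJ Ψstar p.1 p.2
  have hd := hdiff T hT
  have hℓ : HasFDerivAt S.q
      (fderiv ℝ (fun p : EuclideanSpace ℝ (Fin ns) × EuclideanSpace ℝ (Fin na) =>
        Q Ψstar p.1 p.2) zs) zs := by
    rw [hq]; exact hd.hasFDerivAt
  set ℓ := fderiv ℝ (fun p : EuclideanSpace ℝ (Fin ns) × EuclideanSpace ℝ (Fin na) =>
        Q Ψstar p.1 p.2) zs with hℓdef
  have hℓG : ∀ u, ℓ (0, u) = inner ℝ G u := by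
    intro u
    have h1 : HasFDerivAt (fun a' => Q Ψstar (st Ψstar s₀ a₀ T) a')
        (ℓ.comp (ContinuousLinearMap.inr ℝ _ _)) (ac Ψstar s₀ a₀ T) :=
      HasFDerivAt.comp (ac Ψstar s₀ a₀ T) (hd.hasFDerivAt)
        (hasFDerivAt_prodMk_right (st Ψstar s₀ a₀ T) (ac Ψstar s₀ a₀ T))
    rw [hGdef, gradient, h1.fderiv, InnerProductSpace.toDual_symm_apply]
    simp
  have hpos : 0 < ℓ (S.P zs) := by
    show 0 < ℓ (0, v - Ψstar zs.1 zs.2)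
    rw [hℓG]; exact hinn
  obtain ⟨Lr, U, hU, hLr⟩ := ((hrsmooth.of_le (by exact_mod_cast le_top) :
    ContDiff ℝ 1 r).contDiffAt (x := zs.1)).exists_lipschitzOnWith
  obtain ⟨r2, hr2, hr2U⟩ := Metric.nhds_basis_closedBall.mem_iff.1 hU
  have hρ : ∀ z w, ‖z - zs‖ ≤ r2 → ‖w - zs‖ ≤ r2 → |S.ρ z - S.ρ w| ≤ (Lr : ℝ) * ‖z - w‖ := by
    intro z w hz hw
    have m1 : ∀ z : EuclideanSpace ℝ (Fin ns) × EuclideanSpace ℝ (Fin na),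
        ‖z - zs‖ ≤ r2 → z.1 ∈ U := fun z hz => hr2U (by
      rw [Metric.mem_closedBall, dist_eq_norm]
      exact (norm_fst_le (z - zs)).trans hz)
    have h1 := hLr.dist_le_mul _ (m1 z hz) _ (m1 w hw)
    rw [Real.dist_eq, dist_eq_norm] at h1
    refine h1.trans (mul_le_mul_of_nonneg_left ?_ Lr.2)
    exact norm_fst_le (z - w)
  have hzsΦ : S.Φ (s₀, a₀) T = zs := by
    show (st Ψstar s₀ a₀ (max T 0), ac Ψstar s₀ a₀ (max T 0)) = zs
    rw [max_eq_left hT]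
  obtain ⟨δ, hδ, β, hβ0, hβ1, hwin⟩ := S.core hT hzsΦ hℓ hpos Lr.2 hr2 hρ
  let φ : ContDiffBump zs := ⟨δ / 2, δ, by positivity, by linarith⟩
  set ψ : EuclideanSpace ℝ (Fin ns) × EuclideanSpace ℝ (Fin na) → ℝ := fun z => β * φ z with hψdef
  have hψs : ContDiff ℝ (⊤ : ℕ∞) ψ := contDiff_const.mul φ.contDiff
  have hψ0 : ∀ z, 0 ≤ ψ z := fun z => mul_nonneg hβ0.le φ.nonneg
  have hψβ : ∀ z, ψ z ≤ β := fun z => by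
    have := φ.le_one (x := z)
    show β * φ z ≤ β
    nlinarith
  have hψc : HasCompactSupport ψ := φ.hasCompactSupport.mul_left
  let Ψn : EuclideanSpace ℝ (Fin ns) → EuclideanSpace ℝ (Fin na) → EuclideanSpace ℝ (Fin na) :=
    fun s a => Ψstar s a + ψ (s, a) • (v - Ψstar s a)
  have hadm : QSM.Admissible C Ψn := by
    have hs2 : ContDiff ℝ (⊤ : ℕ∞)
        (fun p : EuclideanSpace ℝ (Fin ns) × EuclideanSpace ℝ (Fin na) =>
          ψ p • (v - Ψstar p.1 p.2)) := hψs.smul (contDiff_const.sub hsm)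
    refine ⟨hsm.add hs2, ?_, ?_⟩
    · obtain ⟨K2, hK2⟩ := ContDiff.lipschitzWith_of_hasCompactSupport
        (hψc.smul_right (f' := fun p : EuclideanSpace ℝ (Fin ns) × EuclideanSpace ℝ (Fin na) =>
          v - Ψstar p.1 p.2)) hs2 (by simp)
      exact ⟨_, hKΨ.add hK2⟩
    · intro s a
      have e : Ψn s a = (1 - ψ (s, a)) • Ψstar s a + ψ (s, a) • v := by
        show Ψstar s a + ψ (s, a) • (v - Ψstar s a) = _
        module
      rw [e]
      refine (norm_add_le _ _).trans ?_
      have h1 : 0 ≤ 1 - ψ (s, a) := by linarith [hψβ (s, a)]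
      rw [norm_smul, norm_smul, Real.norm_of_nonneg h1, Real.norm_of_nonneg (hψ0 _), hvn]
      nlinarith [hbd s a]
  have hsol : S.Sol ψ (fun t => (st Ψn s₀ a₀ (max t 0), ac Ψn s₀ a₀ (max t 0))) := by
    refine ⟨hψs.continuous, hψ0, ?_, ?_⟩
    · exact (QSMaux.ext_right fun t ht => (hODE Ψn hadm s₀ a₀ t ht).1).1.prodMk
        (QSMaux.ext_right fun t ht => (hODE Ψn hadm s₀ a₀ t ht).2).1
    · intro t ht
      have h1 := (QSMaux.ext_right fun t ht => (hODE Ψn hadm s₀ a₀ t ht).1).2 t ht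
      have h2 := (QSMaux.ext_right fun t ht => (hODE Ψn hadm s₀ a₀ t ht).2).2 t ht
      have h3 := h1.prodMk h2
      have e : S.f (st Ψn s₀ a₀ (max t 0), ac Ψn s₀ a₀ (max t 0))
          + ψ (st Ψn s₀ a₀ (max t 0), ac Ψn s₀ a₀ (max t 0)) •
            S.P (st Ψn s₀ a₀ (max t 0), ac Ψn s₀ a₀ (max t 0))
          = (F (st Ψn s₀ a₀ t) (ac Ψn s₀ a₀ t), Ψn (st Ψn s₀ a₀ t) (ac Ψn s₀ a₀ t)) := by
        rw [max_eq_left ht]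
        show (F _ _, Ψstar _ _) + ψ _ • ((0 : EuclideanSpace ℝ (Fin ns)), v - Ψstar _ _) = _
        rw [Prod.smul_mk, smul_zero, Prod.mk_add_mk, add_zero]
      exact HasDerivWithinAt.congr_deriv h3 e.symm
  have hx0 : (fun t => (st Ψn s₀ a₀ (max t 0), ac Ψn s₀ a₀ (max t 0))) (0:ℝ) = (s₀, a₀) := by
    have := hinit Ψn hadm s₀ a₀
    simp [this.1, this.2]
  have hfinal := hwin ψ _ hsol hψβ hx0
    (fun z hz => by
      show β * φ z = 0
      rw [φ.zero_of_le_dist (by rw [dist_eq_norm]; exact hz), mul_zero])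
    (fun z hz => by
      show β * φ z = β
      rw [φ.one_of_mem_closedBall (by rw [Metric.mem_closedBall, dist_eq_norm]; exact hz), mul_one])
  rw [hJ, hq] at hfinal
  exact absurd (hmax Ψn hadm) (not_le.2 hfinal)
end

section
/- In the setting of the K-step chain: let p_τ, q_θ, m_θ be as above with all the stated positivity, differentiability, and differentiation-under-the-integral hypotheses holding for (Lebesgue-)almost every a^K, and additionally assume a^K ↦ m_θ(a^K) is a probability density on ℝ^a for each θ near θ₀. Let Q : ℝ^a → ℝ be bounded and measurable, and assume all the integrals below are finite. Then ∫_{ℝ^a} Q(a^K) · ∇_θ log m_{θ₀}(a^K) · m_{θ₀}(a^K) da^K = ∫_{(ℝ^a)^K} Q(a^K) · ( ∑_{τ=1}^K ∇_θ log p_τ(θ₀, a^τ, a^{τ−1}) ) · q_{θ₀}(a¹, …, a^K) da¹ ⋯ da^K; that is, the expectation over a^K ∼ m_{θ₀} of Q(a^K) times the score of the marginal equals the expectation over the full internal chain (a¹, …, a^K) ∼ q_{θ₀} of Q(a^K) times the sum of transition scores. -/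
open MeasureTheory Real Filter

/-- The joint density of a `K`-step chain: `q_θ(a¹,…,a^K) = ∏_{τ=1}^K p_τ(θ, a^τ, a^{τ-1})`,
where the chain is encoded as a function `c : ℕ → ℝᵃ` (with `c 0` the dummy initial
point `a⁰` and `c τ = a^τ`), and `p τ` stands for the transition density `p_{τ+1}`. -/
noncomputable def QSM.joint {d na : ℕ} (K : ℕ)
    (p : ℕ → EuclideanSpace ℝ (Fin d) → EuclideanSpace ℝ (Fin na) →
      EuclideanSpace ℝ (Fin na) → ℝ)
    (θ : EuclideanSpace ℝ (Fin d)) (c : ℕ → EuclideanSpace ℝ (Fin na)) : ℝ :=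
  ∏ τ ∈ Finset.range K, p τ θ (c (τ + 1)) (c τ)

/-- Assemble a full chain `ℕ → ℝᵃ` from the internal actions `u = (a¹,…,a^{K-1})` and
the final action `a^K`, with the dummy initial point `a⁰ = 0`. -/
noncomputable def QSM.chain {na : ℕ} (K : ℕ)
    (u : Fin (K - 1) → EuclideanSpace ℝ (Fin na))
    (aK : EuclideanSpace ℝ (Fin na)) : ℕ → EuclideanSpace ℝ (Fin na) :=
  fun τ => if τ = 0 then 0 else if τ = K then aK
    else if h : τ - 1 < K - 1 then u ⟨τ - 1, h⟩ else 0

/-- Assemble a full chain `ℕ → ℝᵃ` from all the actions `w = (a¹,…,a^K)`, with the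
dummy initial point `a⁰ = 0`; in particular `QSM.fullChain K w K = a^K`. -/
noncomputable def QSM.fullChain {na : ℕ} (K : ℕ)
    (w : Fin K → EuclideanSpace ℝ (Fin na)) : ℕ → EuclideanSpace ℝ (Fin na) :=
  fun τ => if τ = 0 then 0 else if h : τ - 1 < K then w ⟨τ - 1, h⟩ else 0

/-- The marginal density of the final action:
`m_θ(a^K) = ∫ q_θ(a¹,…,a^K) da¹ ⋯ da^{K-1}` (Lebesgue measure on the internals). -/
noncomputable def QSM.marginal {d na : ℕ} (K : ℕ)
    (p : ℕ → EuclideanSpace ℝ (Fin d) → EuclideanSpace ℝ (Fin na) →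
      EuclideanSpace ℝ (Fin na) → ℝ)
    (θ : EuclideanSpace ℝ (Fin d)) (aK : EuclideanSpace ℝ (Fin na)) : ℝ :=
  ∫ u : Fin (K - 1) → EuclideanSpace ℝ (Fin na), QSM.joint K p θ (QSM.chain K u aK)

lemma QSM.smul_gradient_log {d : ℕ} (f : EuclideanSpace ℝ (Fin d) → ℝ)
    (x : EuclideanSpace ℝ (Fin d)) (hf : DifferentiableAt ℝ f x) (h0 : f x ≠ 0) :
    f x • gradient (fun θ => Real.log (f θ)) x = gradient f x := by
  unfold gradient
  rw [fderiv.log hf h0, map_smulₛₗ, smul_smul]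
  simp [h0]

lemma QSM.gradient_log_prod {d : ℕ} (K : ℕ) (f : ℕ → EuclideanSpace ℝ (Fin d) → ℝ)
    (x : EuclideanSpace ℝ (Fin d)) (hf : ∀ τ < K, DifferentiableAt ℝ (f τ) x)
    (h0 : ∀ τ < K, ∀ θ, 0 < f τ θ) :
    (∏ τ ∈ Finset.range K, f τ x) • ∑ τ ∈ Finset.range K,
      gradient (fun θ => Real.log (f τ θ)) x
      = gradient (fun θ => ∏ τ ∈ Finset.range K, f τ θ) x := by
  have hd : DifferentiableAt ℝ (fun θ => ∏ τ ∈ Finset.range K, f τ θ) x :=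
    (HasFDerivAt.finsetProd (u := Finset.range K) (fun τ hτ =>
      (hf τ (Finset.mem_range.1 hτ)).hasFDerivAt)).differentiableAt
  have hp : ∏ τ ∈ Finset.range K, f τ x ≠ 0 :=
    Finset.prod_ne_zero_iff.2 fun τ hτ => (h0 τ (Finset.mem_range.1 hτ) x).ne'
  rw [← QSM.smul_gradient_log _ x hd hp]
  congr 1
  have : (fun θ => Real.log (∏ τ ∈ Finset.range K, f τ θ))
      = fun θ => ∑ τ ∈ Finset.range K, Real.log (f τ θ) := by
    funext θ
    exact Real.log_prod fun τ hτ => (h0 τ (Finset.mem_range.1 hτ) θ).ne'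
  rw [this]
  unfold gradient
  rw [fderiv_fun_sum fun τ hτ => (hf τ (Finset.mem_range.1 hτ)).log
    (h0 τ (Finset.mem_range.1 hτ) x).ne', map_sum]

lemma QSM.fullChain_insertNth {na : ℕ} (n : ℕ) (u : Fin n → EuclideanSpace ℝ (Fin na))
    (a : EuclideanSpace ℝ (Fin na)) :
    QSM.fullChain (n + 1) ((Fin.last n).insertNth (α := fun _ => EuclideanSpace ℝ (Fin na)) a u)
      = QSM.chain (n + 1) u a := by
  funext τ
  unfold QSM.fullChain QSM.chain
  rcases τ with _ | τ
  · simp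
  · simp only [Fin.insertNth_last', Nat.add_sub_cancel]
    by_cases h1 : τ = n
    · subst h1
      simp [Fin.snoc]
    · by_cases h2 : τ < n
      · have h3 : τ < n + 1 := by omega
        simp [h1, h2, h3, Fin.snoc]
      · have h3 : ¬ τ < n + 1 := by omega
        simp [h1, h2, h3]

/-- single-time-step policy gradient identity for a `K`-step chain:
with the hypotheses of Statement 10 holding for almost every final action `a^K`, the
marginal `m_θ` a probability density for `θ` near `θ₀`, `Q` bounded measurable, and
both integrands integrable, the expectation over `a^K ∼ m_{θ₀}` of
`Q(a^K)·∇ log m_{θ₀}(a^K)` equals the expectation over the full internal chain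
`(a¹,…,a^K) ∼ q_{θ₀}` of `Q(a^K)·(∑_τ ∇ log p_τ)`. -/
theorem qsm_stmt11 {d na K : ℕ} (hK : 1 ≤ K) (hd : 1 ≤ d)
    (p : ℕ → EuclideanSpace ℝ (Fin d) → EuclideanSpace ℝ (Fin na) →
      EuclideanSpace ℝ (Fin na) → ℝ)
    -- strict positivity of the transition densities
    (hp_pos : ∀ τ < K, ∀ θ x y, 0 < p τ θ x y)
    -- p_1 does not depend on the dummy initial point a⁰
    (hp1 : ∀ θ x y y', p 0 θ x y = p 0 θ x y')
    (θ₀ : EuclideanSpace ℝ (Fin d))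
    -- differentiability of each transition density in θ at θ₀
    (hp_diff : ∀ τ < K, ∀ x y, DifferentiableAt ℝ (fun θ => p τ θ x y) θ₀)
    -- the Statement-10 hypotheses hold for (Lebesgue-)almost every a^K
    (hae : ∀ᵐ aK : EuclideanSpace ℝ (Fin na),
      Integrable (fun u : Fin (K - 1) → EuclideanSpace ℝ (Fin na) =>
        QSM.joint K p θ₀ (QSM.chain K u aK)) ∧
      0 < QSM.marginal K p θ₀ aK ∧
      DifferentiableAt ℝ (fun θ => QSM.marginal K p θ aK) θ₀ ∧
      gradient (fun θ => QSM.marginal K p θ aK) θ₀ =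
        ∫ u : Fin (K - 1) → EuclideanSpace ℝ (Fin na),
          gradient (fun θ => QSM.joint K p θ (QSM.chain K u aK)) θ₀)
    -- the marginal is a probability density for θ near θ₀
    (hprob : ∀ᶠ θ in nhds θ₀,
      ∫ aK : EuclideanSpace ℝ (Fin na), QSM.marginal K p θ aK = 1)
    -- Q is bounded and measurable
    (Q : EuclideanSpace ℝ (Fin na) → ℝ)
    (hQmeas : Measurable Q) (hQbdd : ∃ B : ℝ, ∀ x, |Q x| ≤ B)
    -- both integrals below are finite
    (hint1 : Integrable (fun aK : EuclideanSpace ℝ (Fin na) =>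
      (Q aK * QSM.marginal K p θ₀ aK) •
        gradient (fun θ => Real.log (QSM.marginal K p θ aK)) θ₀))
    (hint2 : Integrable (fun w : Fin K → EuclideanSpace ℝ (Fin na) =>
      (Q (QSM.fullChain K w K) * QSM.joint K p θ₀ (QSM.fullChain K w)) •
        ∑ τ ∈ Finset.range K,
          gradient (fun θ =>
            Real.log (p τ θ (QSM.fullChain K w (τ + 1)) (QSM.fullChain K w τ))) θ₀)) :
    (∫ aK : EuclideanSpace ℝ (Fin na),
      (Q aK * QSM.marginal K p θ₀ aK) •
        gradient (fun θ => Real.log (QSM.marginal K p θ aK)) θ₀) =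
    ∫ w : Fin K → EuclideanSpace ℝ (Fin na),
      (Q (QSM.fullChain K w K) * QSM.joint K p θ₀ (QSM.fullChain K w)) •
        ∑ τ ∈ Finset.range K,
          gradient (fun θ =>
            Real.log (p τ θ (QSM.fullChain K w (τ + 1)) (QSM.fullChain K w τ))) θ₀ := by
  obtain ⟨n, rfl⟩ : ∃ n, K = n + 1 := ⟨K - 1, by omega⟩
  have hmp := (volume_preserving_piFinSuccAbove
    (fun _ : Fin (n + 1) => EuclideanSpace ℝ (Fin na)) (Fin.last n)).symm
  rw [← hmp.integrable_comp_emb (MeasurableEquiv.measurableEmbedding _)] at hint2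
  rw [← hmp.integral_comp (MeasurableEquiv.measurableEmbedding _)]
  rw [Measure.volume_eq_prod] at hint2 ⊢
  refine Eq.trans ?_ (integral_prod _ hint2).symm
  refine integral_congr_ae ?_
  filter_upwards [hae] with a ha
  obtain ⟨-, hpos, hdiff, hgrad⟩ := ha
  rw [mul_smul, QSM.smul_gradient_log _ θ₀ hdiff hpos.ne', hgrad, ← integral_smul]
  refine integral_congr_ae (Eventually.of_forall fun u => ?_)
  have key : QSM.fullChain (n + 1) ((MeasurableEquiv.piFinSuccAbove
      (fun _ : Fin (n + 1) => EuclideanSpace ℝ (Fin na)) (Fin.last n)).symm (a, u))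
      = QSM.chain (n + 1) u a := QSM.fullChain_insertNth n u a
  have hlast : QSM.chain (n + 1) u a (n + 1) = a := by simp [QSM.chain]
  simp only [Function.comp_apply, key, hlast]
  rw [mul_smul]
  congr 1
  exact (QSM.gradient_log_prod (n + 1)
    (fun τ θ => p τ θ (QSM.chain (n + 1) u a (τ + 1)) (QSM.chain (n + 1) u a τ)) θ₀
    (fun τ hτ => hp_diff τ hτ _ _) (fun τ hτ θ => hp_pos τ hτ θ _ _)).symm
end
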